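/- (Lemma 5.) Let p be a concave bivariate polynomial of degree 4 and suppose P = conv{x ∈ ℝ² : p(x) = 0} is compact with nonempty interior. Then P = P₂, i.e. the first Lasserre relaxation of P is exact. -/

import Mathlib

/-- Evaluation of a bivariate polynomial of degree at most 4, given by its
coefficients `c i j` of the monomials `x₁^i * x₂^j`. -/
noncomputable def evalPoly (c : ℕ → ℕ → ℝ) (x : ℝ × ℝ) : ℝ :=
  ∑ i ∈ Finset.range 5, ∑ j ∈ Finset.range 5, c i j * x.1 ^ i * x.2 ^ j

/-- The six monomials of degree at most 2 indexing the moment matrix. -/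
def momIdx : Fin 6 → ℕ × ℕ := ![(0,0), (1,0), (0,1), (2,0), (1,1), (0,2)]

/-- The 6×6 moment matrix `M(y)` with entries `M_{(a,b),(c,d)} = y_{a+c,b+d}`. -/
def momMat (y : ℕ → ℕ → ℝ) : Matrix (Fin 6) (Fin 6) ℝ :=
  Matrix.of fun a b => y ((momIdx a).1 + (momIdx b).1) ((momIdx a).2 + (momIdx b).2)

/-- The first Lasserre relaxation `P₂` of `conv {x : p(x) = 0}`. -/
def lasserre2 (c : ℕ → ℕ → ℝ) : Set (ℝ × ℝ) :=
  {x | ∃ y : ℕ → ℕ → ℝ, y 0 0 = 1 ∧ y 1 0 = x.1 ∧ y 0 1 = x.2 ∧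
    (∑ i ∈ Finset.range 5, ∑ j ∈ Finset.range 5, c i j * y i j) = 0 ∧
    (momMat y).PosSemidef}

open Matrix

open scoped MatrixOrder in
/-- Simultaneous diagonalization by congruence of a positive definite and a symmetric matrix. -/
theorem Matrix.PosDef.exists_simultaneous_diagonalization {n : Type*} [Fintype n] [DecidableEq n]
    {A B : Matrix n n ℝ} (hA : A.PosDef) (hB : Bᵀ = B) :
    ∃ (W : Matrix n n ℝ) (d : n → ℝ), IsUnit W.det ∧ A = W * Wᵀ ∧ B = W * diagonal d * Wᵀ := by
  obtain ⟨S, hS⟩ := CStarAlgebra.nonneg_iff_eq_star_mul_self.mp hA.posSemidef.nonneg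
  replace hS : A = Sᵀ * S := by simpa [star_eq_conjTranspose] using hS
  have hSdet : IsUnit S.det := by
    have h := (isUnit_iff_isUnit_det A).mp hA.isUnit
    rw [hS, det_mul] at h
    exact isUnit_of_mul_isUnit_right h
  have hSdet' : IsUnit Sᵀ.det := by rwa [det_transpose]
  have hH : (Sᵀ⁻¹ * B * S⁻¹).IsHermitian := by
    simp [IsHermitian, conjTranspose_eq_transpose_of_trivial, hB, Matrix.mul_assoc,
      transpose_nonsing_inv]
  let U : Matrix n n ℝ := hH.eigenvectorUnitary
  have hU : U * Uᵀ = 1 := by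
    simpa [star_eq_conjTranspose, U] using Unitary.coe_mul_star_self hH.eigenvectorUnitary
  have hspec : Sᵀ⁻¹ * B * S⁻¹ = U * diagonal hH.eigenvalues * Uᵀ := by
    have h := hH.spectral_theorem
    rw [Unitary.conjStarAlgAut_apply] at h
    simpa [star_eq_conjTranspose, U, Function.comp_def] using h
  refine ⟨Sᵀ * U, hH.eigenvalues, ?_, ?_, ?_⟩
  · rw [det_mul]
    refine hSdet'.mul ?_
    have := congrArg det hU
    rw [det_mul, det_one] at this
    exact IsUnit.of_mul_eq_one _ this
  · rw [hS, transpose_mul, transpose_transpose, Matrix.mul_assoc, ← Matrix.mul_assoc U, hU,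
      Matrix.one_mul]
  · calc B = Sᵀ * (Sᵀ⁻¹ * B * S⁻¹) * S := by
          rw [Matrix.mul_assoc, Matrix.mul_assoc, nonsing_inv_mul _ hSdet, Matrix.mul_one,
            mul_nonsing_inv_cancel_left _ _ hSdet']
      _ = _ := by
          refine (congrArg (fun M => Sᵀ * M * S) hspec).trans ?_
          simp only [transpose_mul, transpose_transpose, Matrix.mul_assoc]

theorem Matrix.PosSemidef.trace_mul_nonneg_of_forall {n : Type*} [Fintype n]
    {Q R : Matrix n n ℝ} (hR : R.PosSemidef) (hQ : ∀ v, 0 ≤ v ⬝ᵥ Q *ᵥ v) :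
    0 ≤ (Q * R).trace := by
  obtain ⟨m, v, rfl⟩ := posSemidef_iff_eq_sum_vecMulVec.mp hR
  rw [Finset.mul_sum, trace_sum]
  refine Finset.sum_nonneg fun i _ => ?_
  rw [mul_vecMulVec, trace_vecMulVec, dotProduct_comm]
  simpa using hQ (v i)

theorem Matrix.trace_mul_congr_diagonal {n : Type*} [Fintype n] [DecidableEq n]
    (Q W : Matrix n n ℝ) (d : n → ℝ) :
    (Q * (W * diagonal d * Wᵀ)).trace = ∑ i, d i * (W.col i ⬝ᵥ Q *ᵥ W.col i) := by
  have h : (Q * (W * diagonal d * Wᵀ)).trace = (diagonal d * (Wᵀ * (Q * W))).trace := by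
    rw [← Matrix.mul_assoc, trace_mul_comm, ← Matrix.mul_assoc Q, ← Matrix.mul_assoc,
      trace_mul_comm]
  rw [h]
  simp only [trace, diag_apply, diagonal_mul]
  rfl

theorem biquadratic_trace_nonneg_of_posDef {n : Type*} [Fintype n] [DecidableEq n]
    {Q₁ Q₂ Q₃ A B C : Matrix n n ℝ}
    (hQ : ∀ (b : ℝ) (v : n → ℝ),
      0 ≤ v ⬝ᵥ Q₁ *ᵥ v + 2 * b * (v ⬝ᵥ Q₂ *ᵥ v) + b ^ 2 * (v ⬝ᵥ Q₃ *ᵥ v))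
    (hQ₃ : ∀ v, 0 ≤ v ⬝ᵥ Q₃ *ᵥ v)
    (hA : A.PosDef) (hB : Bᵀ = B) (h : (fromBlocks A B B C).PosSemidef) :
    0 ≤ (Q₁ * A).trace + 2 * (Q₂ * B).trace + (Q₃ * C).trace := by
  have hBH : Bᴴ = B := by rwa [conjTranspose_eq_transpose_of_trivial]
  have : Invertible A := hA.isUnit.invertible
  have hR : (C - B * A⁻¹ * B).PosSemidef := by
    simpa only [hBH] using (PosDef.fromBlocks₁₁ B C hA).mp (by rwa [hBH])
  obtain ⟨W, d, hW, rfl, rfl⟩ := hA.exists_simultaneous_diagonalization hB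
  have hW' : IsUnit Wᵀ.det := by rwa [det_transpose]
  have hsq : W * diagonal d * Wᵀ * (W * Wᵀ)⁻¹ * (W * diagonal d * Wᵀ)
      = W * diagonal (fun i => d i ^ 2) * Wᵀ := by
    rw [Matrix.mul_inv_rev]
    simp only [Matrix.mul_assoc]
    rw [nonsing_inv_mul_cancel_left _ _ hW, mul_nonsing_inv_cancel_left _ _ hW',
      ← Matrix.mul_assoc (diagonal d), diagonal_mul_diagonal]
    simp only [sq]
  rw [hsq] at hR
  have h₃ := hR.trace_mul_nonneg_of_forall hQ₃
  have h₁ : W * Wᵀ = W * diagonal (fun _ => 1) * Wᵀ := by simp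
  rw [Matrix.mul_sub, trace_sub, trace_mul_congr_diagonal] at h₃
  rw [h₁, trace_mul_congr_diagonal, trace_mul_congr_diagonal, Finset.mul_sum]
  have h₂ : 0 ≤ ∑ i, (1 * (W.col i ⬝ᵥ Q₁ *ᵥ W.col i) + 2 * (d i * (W.col i ⬝ᵥ Q₂ *ᵥ W.col i))
      + d i ^ 2 * (W.col i ⬝ᵥ Q₃ *ᵥ W.col i)) :=
    Finset.sum_nonneg fun i _ => by linarith [hQ (d i) (W.col i)]
  rw [Finset.sum_add_distrib, Finset.sum_add_distrib] at h₂
  linarith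

/-- A nonnegative biquadratic form pairs nonnegatively with a positive semidefinite `2 × 2` block
matrix whose off-diagonal block is symmetric. -/
theorem biquadratic_trace_nonneg {n : Type*} [Fintype n] [DecidableEq n]
    {Q₁ Q₂ Q₃ A B C : Matrix n n ℝ}
    (hQ : ∀ (b : ℝ) (v : n → ℝ),
      0 ≤ v ⬝ᵥ Q₁ *ᵥ v + 2 * b * (v ⬝ᵥ Q₂ *ᵥ v) + b ^ 2 * (v ⬝ᵥ Q₃ *ᵥ v))
    (hQ₃ : ∀ v, 0 ≤ v ⬝ᵥ Q₃ *ᵥ v)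
    (hB : Bᵀ = B) (h : (fromBlocks A B B C).PosSemidef) :
    0 ≤ (Q₁ * A).trace + 2 * (Q₂ * B).trace + (Q₃ * C).trace := by
  have hA : A.PosSemidef := by simpa using! h.submatrix Sum.inl
  have key : ∀ ε > (0 : ℝ), 0 ≤ (Q₁ * A).trace + 2 * (Q₂ * B).trace + (Q₃ * C).trace
      + ε * Q₁.trace := by
    intro ε hε
    have hε1 : (ε • (1 : Matrix n n ℝ)).PosDef := PosDef.one.smul hε
    have hblock : (fromBlocks (ε • (1 : Matrix n n ℝ)) 0 0 (0 : Matrix n n ℝ)).PosSemidef := by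
      have := hε1.isUnit.invertible
      have h0 := (PosDef.fromBlocks₁₁ (0 : Matrix n n ℝ) 0 hε1).mpr
        (by simpa using PosSemidef.zero)
      simpa using h0
    have hsum := h.add hblock
    rw [fromBlocks_add, add_zero, add_zero] at hsum
    have := biquadratic_trace_nonneg_of_posDef hQ hQ₃ (hε1.posSemidef_add hA) hB hsum
    rw [Matrix.mul_add, trace_add] at this
    simp at this
    linarith
  by_contra! hneg
  set X := (Q₁ * A).trace + 2 * (Q₂ * B).trace + (Q₃ * C).trace
  have hpos : 0 < 2 * (|Q₁.trace| + 1) := by positivity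
  have := key (-X / (2 * (|Q₁.trace| + 1))) (div_pos (by linarith) hpos)
  have h2 : -X / (2 * (|Q₁.trace| + 1)) * Q₁.trace ≤ -X / 2 := by
    rw [div_mul_eq_mul_div, div_le_div_iff₀ hpos two_pos]
    nlinarith [le_abs_self Q₁.trace]
  linarith

theorem continuous_evalPoly (c : ℕ → ℕ → ℝ) : Continuous (evalPoly c) := by
  unfold evalPoly; fun_prop

theorem isPreconnected_norm_gt {E : Type*} [NormedAddCommGroup E] [NormedSpace ℝ E]
    (h : 1 < Module.rank ℝ E) {R : ℝ} (hR : 0 ≤ R) : IsPreconnected {x : E | R < ‖x‖} := by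
  have himg : {x : E | R < ‖x‖}
      = (fun q : ℝ × E => q.1 • q.2) '' (Set.Ioi R ×ˢ Metric.sphere (0 : E) 1) := by
    ext x
    simp only [Set.mem_ofPred_eq, Set.mem_image, Set.mem_prod, Set.mem_Ioi, mem_sphere_zero_iff_norm,
      Prod.exists]
    constructor
    · intro hx
      have hx0 : ‖x‖ ≠ 0 := (hR.trans_lt hx).ne'
      exact ⟨‖x‖, ‖x‖⁻¹ • x, ⟨hx, by rw [norm_smul, norm_inv, norm_norm, inv_mul_cancel₀ hx0]⟩,
        smul_inv_smul₀ hx0 x⟩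
    · rintro ⟨r, v, ⟨hr, hv⟩, rfl⟩
      rw [norm_smul, hv, mul_one]
      exact hr.trans_le (Real.le_norm_self r)
  rw [himg]
  exact (isPreconnected_Ioi.prod (isPreconnected_sphere h 0 1)).image _ (by fun_prop)

/-- If the zero set of a continuous concave function is bounded and nonempty in dimension at least
two, then its convex hull contains every point where the function is nonnegative. -/
theorem mem_convexHull_zeros_of_nonneg {E : Type*} [NormedAddCommGroup E] [NormedSpace ℝ E]
    (h : 1 < Module.rank ℝ E) {f : E → ℝ} (hf : Continuous f) (hconc : ConcaveOn ℝ Set.univ f)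
    (hbdd : Bornology.IsBounded {x | f x = 0}) (hne : ∃ x, f x = 0) {x : E} (hx : 0 ≤ f x) :
    x ∈ convexHull ℝ {x | f x = 0} := by
  obtain ⟨R₀, hR₀⟩ := hbdd.exists_norm_le
  set R := max R₀ 0
  have hR : ∀ z, R < ‖z‖ → f z ≠ 0 := fun z hz h0 =>
    absurd (hR₀ z h0) (not_le.mpr ((le_max_left _ _).trans_lt hz))
  have hconn := isPreconnected_norm_gt h (le_max_right R₀ 0)
  have : Nontrivial E := by
    rw [← rank_pos_iff_nontrivial (R := ℝ)]
    exact zero_lt_one.trans h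
  -- far out on both sides of any point
  have hfar : ∀ z : E, ∃ w : E, R < ‖z + w‖ ∧ R < ‖z - w‖ := by
    intro z
    obtain ⟨w, hw⟩ := exists_norm_eq E (c := R + ‖z‖ + 1)
      (by have := le_max_right R₀ 0; have := norm_nonneg z; change 0 ≤ R at *; positivity)
    refine ⟨w, ?_, ?_⟩
    · have := norm_sub_norm_le w (-z)
      rw [norm_neg, sub_neg_eq_add, add_comm w] at this
      linarith
    · have := norm_sub_norm_le w z
      rw [norm_sub_rev] at this
      linarith
  have hneg : ∀ z, R < ‖z‖ → f z < 0 := by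
    intro z hz
    by_contra! hz0
    obtain ⟨x₀, hx₀⟩ := hne
    have hpos : ∀ w, R < ‖w‖ → 0 < f w := by
      intro w hw
      by_contra! hw0
      obtain ⟨u, hu, hu0⟩ := hconn.intermediate_value hw hz hf.continuousOn ⟨hw0, hz0⟩
      exact hR u hu hu0
    obtain ⟨w, hw₁, hw₂⟩ := hfar x₀
    have := hconc.2 (Set.mem_univ (x₀ + w)) (Set.mem_univ (x₀ - w))
      (show (0 : ℝ) ≤ 1 / 2 by norm_num) (show (0 : ℝ) ≤ 1 / 2 by norm_num) (by norm_num)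
     
    have he : (1 / 2 : ℝ) • (x₀ + w) + (1 / 2 : ℝ) • (x₀ - w) = x₀ := by module
    rw [he, hx₀, smul_eq_mul, smul_eq_mul] at this
    linarith [hpos _ hw₁, hpos _ hw₂]
  obtain ⟨w, hw₁, hw₂⟩ := hfar x
  have hzero : ∀ u : E, f (x + u) < 0 → ∃ t : ℝ, 0 ≤ t ∧ f (x + t • u) = 0 := by
    intro u hu
    obtain ⟨t, ht, ht0⟩ := intermediate_value_Icc' (f := fun t : ℝ => f (x + t • u)) zero_le_one
      (by fun_prop) (show (0 : ℝ) ∈ _ by simpa using ⟨hu.le, hx⟩)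
    exact ⟨t, ht.1, ht0⟩
  obtain ⟨s, hs, hs0⟩ := hzero w (hneg _ hw₁)
  obtain ⟨t, ht, ht0⟩ := hzero (-w) (by simpa [sub_eq_add_neg] using hneg _ hw₂)
  rcases (add_nonneg hs ht).eq_or_lt with hst | hst
  · have : s = 0 := by linarith
    exact subset_convexHull ℝ _ (by simpa [this] using hs0)
  · have := (convex_convexHull ℝ {x | f x = 0}) (subset_convexHull ℝ _ hs0)
      (subset_convexHull ℝ _ ht0) (a := t / (s + t)) (b := s / (s + t)) (by positivity)
      (by positivity) (by field_simp; ring)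
    convert this using 1
    have h1 : x = (t / (s + t) + s / (s + t)) • x + (t / (s + t) * s - s / (s + t) * t) • w := by
      rw [show t / (s + t) + s / (s + t) = 1 by field_simp; ring,
        show t / (s + t) * s - s / (s + t) * t = 0 by ring]
      simp
    conv_lhs => rw [h1]
    module

/-- The coefficients, in the homogenized point `(1, x₁, x₂)`, of the entry `∂₁∂₁` of the Hessian
of a bivariate quartic. -/
def hess₁₁ (c : ℕ → ℕ → ℝ) : Matrix (Fin 3) (Fin 3) ℝ :=
  !![2 * c 2 0, 3 * c 3 0, c 2 1; 3 * c 3 0, 12 * c 4 0, 3 * c 3 1; c 2 1, 3 * c 3 1, 2 * c 2 2]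

/-- The coefficients of the entry `∂₁∂₂` of the Hessian of a bivariate quartic. -/
def hess₁₂ (c : ℕ → ℕ → ℝ) : Matrix (Fin 3) (Fin 3) ℝ :=
  !![c 1 1, c 2 1, c 1 2; c 2 1, 3 * c 3 1, 2 * c 2 2; c 1 2, 2 * c 2 2, 3 * c 1 3]

/-- The coefficients of the entry `∂₂∂₂` of the Hessian of a bivariate quartic. -/
def hess₂₂ (c : ℕ → ℕ → ℝ) : Matrix (Fin 3) (Fin 3) ℝ :=
  !![2 * c 0 2, c 1 2, 3 * c 0 3; c 1 2, 2 * c 2 2, 3 * c 1 3; 3 * c 0 3, 3 * c 1 3, 12 * c 0 4]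

/-- The Hessian form of a bivariate quartic in the direction `u`, at the homogenized point `v`. -/
def hessForm (c : ℕ → ℕ → ℝ) (u : ℝ × ℝ) (v : Fin 3 → ℝ) : ℝ :=
  u.1 ^ 2 * (v ⬝ᵥ hess₁₁ c *ᵥ v) + 2 * u.1 * u.2 * (v ⬝ᵥ hess₁₂ c *ᵥ v)
    + u.2 ^ 2 * (v ⬝ᵥ hess₂₂ c *ᵥ v)

theorem hessForm_smul (c : ℕ → ℕ → ℝ) (u : ℝ × ℝ) (s : ℝ) (v : Fin 3 → ℝ) :
    hessForm c u (s • v) = s ^ 2 * hessForm c u v := by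
  simp only [hessForm, mulVec_smul, dotProduct_smul, smul_dotProduct, smul_eq_mul]
  ring

theorem evalPoly_add_add_evalPoly_sub {c : ℕ → ℕ → ℝ} (hsupp : ∀ i j : ℕ, 4 < i + j → c i j = 0)
    (x u : ℝ × ℝ) (t : ℝ) :
    evalPoly c (x + t • u) + evalPoly c (x - t • u) - 2 * evalPoly c x
      = t ^ 2 * (hessForm c u ![1, x.1, x.2] + t ^ 2 * (2 * (c 4 0 * u.1 ^ 4
        + c 3 1 * u.1 ^ 3 * u.2 + c 2 2 * u.1 ^ 2 * u.2 ^ 2 + c 1 3 * u.1 * u.2 ^ 3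
        + c 0 4 * u.2 ^ 4))) := by
  simp [evalPoly, Finset.sum_range_succ, hsupp, hessForm, hess₁₁, hess₁₂, hess₂₂, dotProduct,
    mulVec, Fin.sum_univ_three]
  ring

theorem nonpos_at_zero_of_continuous {h : ℝ → ℝ} (hc : Continuous h) (hle : ∀ s ≠ 0, h s ≤ 0) :
    h 0 ≤ 0 := by
  have hcl : IsClosed {s | h s ≤ 0} := isClosed_le hc continuous_const
  exact hcl.closure_subset_iff.mpr (fun s hs => hle s hs) (dense_compl_singleton (0 : ℝ) 0)

theorem hessForm_nonpos {c : ℕ → ℕ → ℝ} (hsupp : ∀ i j : ℕ, 4 < i + j → c i j = 0)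
    (hconc : ConcaveOn ℝ Set.univ (evalPoly c)) (u : ℝ × ℝ) (v : Fin 3 → ℝ) :
    hessForm c u v ≤ 0 := by
  have haff : ∀ x : ℝ × ℝ, hessForm c u ![1, x.1, x.2] ≤ 0 := by
    intro x
    have := nonpos_at_zero_of_continuous (h := fun t => hessForm c u ![1, x.1, x.2]
      + t ^ 2 * (2 * (c 4 0 * u.1 ^ 4 + c 3 1 * u.1 ^ 3 * u.2 + c 2 2 * u.1 ^ 2 * u.2 ^ 2
        + c 1 3 * u.1 * u.2 ^ 3 + c 0 4 * u.2 ^ 4))) (by fun_prop) (fun t ht => ?_)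
    · simpa using this
    · have hmid := hconc.2 (Set.mem_univ (x + t • u)) (Set.mem_univ (x - t • u))
        (show (0 : ℝ) ≤ 1 / 2 by norm_num) (show (0 : ℝ) ≤ 1 / 2 by norm_num) (by norm_num)
      have he : (1 / 2 : ℝ) • (x + t • u) + (1 / 2 : ℝ) • (x - t • u) = x := by module
      rw [he, smul_eq_mul, smul_eq_mul] at hmid
      have hid := evalPoly_add_add_evalPoly_sub hsupp x u t
      exact nonpos_of_mul_nonpos_right (by rw [← hid]; linarith) (by positivity : 0 < t ^ 2)
  have hhom : ∀ s ≠ 0, hessForm c u ![s, v 1, v 2] ≤ 0 := by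
    intro s hs
    have h := mul_nonpos_of_nonneg_of_nonpos (sq_nonneg s) (haff (v 1 / s, v 2 / s))
    have hvec : (![s, v 1, v 2] : Fin 3 → ℝ) = s • ![1, v 1 / s, v 2 / s] := by
      ext i; fin_cases i <;> simp [mul_div_cancel₀, hs]
    rwa [hvec, hessForm_smul]
  have hv : v = ![v 0, v 1, v 2] := by ext i; fin_cases i <;> rfl
  rw [hv]
  rcases eq_or_ne (v 0) 0 with h0 | h0
  · rw [h0]
    refine nonpos_at_zero_of_continuous (h := fun s => hessForm c u ![s, v 1, v 2]) ?_ hhom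
    simp only [hessForm, dotProduct, mulVec, Fin.sum_univ_three, cons_val]
    fun_prop
  · exact hhom _ h0

theorem hessForm_trace_nonpos {c : ℕ → ℕ → ℝ} (hsupp : ∀ i j : ℕ, 4 < i + j → c i j = 0)
    (hconc : ConcaveOn ℝ Set.univ (evalPoly c)) {A B C : Matrix (Fin 3) (Fin 3) ℝ}
    (hB : Bᵀ = B) (h : (fromBlocks A B B C).PosSemidef) :
    (hess₁₁ c * A).trace + 2 * (hess₁₂ c * B).trace + (hess₂₂ c * C).trace ≤ 0 := by
  have := biquadratic_trace_nonneg (Q₁ := -hess₁₁ c) (Q₂ := -hess₁₂ c) (Q₃ := -hess₂₂ c)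
    (fun b v => ?_) (fun v => ?_) hB h
  · simp only [Matrix.neg_mul, trace_neg] at this
    linarith
  · have := hessForm_nonpos hsupp hconc (1, b) v
    simp only [hessForm, neg_mulVec, dotProduct_neg] at this ⊢
    linarith
  · have := hessForm_nonpos hsupp hconc (0, 1) v
    simp only [hessForm, neg_mulVec, dotProduct_neg] at this ⊢
    linarith

/-- The columns hold the coefficients in `z` of the products of the first entry of
`z - x` with the entries of `(1, (2 * x + z) / 3)`, in the order of `momIdx`. -/
noncomputable def segmentBasis₁ (x : ℝ × ℝ) : Matrix (Fin 6) (Fin 3) ℝ :=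
  !![-x.1, -2 * x.1 ^ 2 / 3, -2 * x.1 * x.2 / 3;
     1, x.1 / 3, 2 * x.2 / 3;
     0, 0, -x.1 / 3;
     0, 1 / 3, 0;
     0, 0, 1 / 3;
     0, 0, 0]

/-- The columns hold the coefficients in `z` of the products of the second entry of
`z - x` with the entries of `(1, (2 * x + z) / 3)`, in the order of `momIdx`. -/
noncomputable def segmentBasis₂ (x : ℝ × ℝ) : Matrix (Fin 6) (Fin 3) ℝ :=
  !![-x.2, -2 * x.1 * x.2 / 3, -2 * x.2 ^ 2 / 3;
     0, -x.2 / 3, 0;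
     1, 2 * x.1 / 3, x.2 / 3;
     0, 0, 0;
     0, 1 / 3, 0;
     0, 0, 1 / 3]

/-- The columns hold the coefficients in `z` of the products of the first entry of
`z - x` with the entries of `(0, z - x)`, in the order of `momIdx`. -/
def infinityBasis₁ (x : ℝ × ℝ) : Matrix (Fin 6) (Fin 3) ℝ :=
  !![0, x.1 ^ 2, x.1 * x.2;
     0, -2 * x.1, -x.2;
     0, 0, -x.1;
     0, 1, 0;
     0, 0, 1;
     0, 0, 0]

/-- The columns hold the coefficients in `z` of the products of the second entry of
`z - x` with the entries of `(0, z - x)`, in the order of `momIdx`. -/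
def infinityBasis₂ (x : ℝ × ℝ) : Matrix (Fin 6) (Fin 3) ℝ :=
  !![0, x.1 * x.2, x.2 ^ 2;
     0, -x.2, 0;
     0, -x.1, -2 * x.2;
     0, 0, 0;
     0, 1, 0;
     0, 0, 1]

theorem hessForm_trace_congr_nonpos {c : ℕ → ℕ → ℝ} (hsupp : ∀ i j : ℕ, 4 < i + j → c i j = 0)
    (hconc : ConcaveOn ℝ Set.univ (evalPoly c)) {M : Matrix (Fin 6) (Fin 6) ℝ}
    (hM : M.PosSemidef) (F G : Matrix (Fin 6) (Fin 3) ℝ)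
    (hFG : Fᵀ * M * G = Gᵀ * M * F) :
    (hess₁₁ c * (Fᵀ * M * F)).trace + 2 * (hess₁₂ c * (Fᵀ * M * G)).trace
      + (hess₂₂ c * (Gᵀ * M * G)).trace ≤ 0 := by
  have hMT : Mᵀ = M := by simpa [conjTranspose_eq_transpose_of_trivial] using hM.isHermitian.eq
  refine hessForm_trace_nonpos hsupp hconc ?_ ?_
  · rw [transpose_mul, transpose_mul, transpose_transpose, hMT, ← Matrix.mul_assoc, hFG]
  · have h := hM.conjTranspose_mul_mul_same (fromCols F G)
    rw [conjTranspose_eq_transpose_of_trivial, transpose_fromCols, fromRows_mul,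
      fromRows_mul_fromCols, ← hFG] at h
    exact h

set_option maxHeartbeats 1600000 in
/-- The Jensen inequality for concave bivariate quartics and pseudo-moment sequences. -/
theorem pseudoMoment_le_evalPoly {c : ℕ → ℕ → ℝ} (hsupp : ∀ i j : ℕ, 4 < i + j → c i j = 0)
    (hconc : ConcaveOn ℝ Set.univ (evalPoly c)) {y : ℕ → ℕ → ℝ} (h0 : y 0 0 = 1)
    (hy : (momMat y).PosSemidef) :
    ∑ i ∈ Finset.range 5, ∑ j ∈ Finset.range 5, c i j * y i j ≤ evalPoly c (y 1 0, y 0 1) := by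
  have h₁ := hessForm_trace_congr_nonpos hsupp hconc hy
    (segmentBasis₁ (y 1 0, y 0 1)) (segmentBasis₂ (y 1 0, y 0 1)) (by
      ext i j
      fin_cases i <;> fin_cases j <;>
      simp [segmentBasis₁, segmentBasis₂, mul_apply, Fin.sum_univ_succ, momMat, momIdx] <;> ring)
  have h₂ := hessForm_trace_congr_nonpos hsupp hconc hy
    (infinityBasis₁ (y 1 0, y 0 1)) (infinityBasis₂ (y 1 0, y 0 1)) (by
      ext i j
      fin_cases i <;> fin_cases j <;>
      simp [infinityBasis₁, infinityBasis₂, mul_apply, Fin.sum_univ_succ, momMat, momIdx] <;> ring)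
  simp only [trace, diag_apply, mul_apply, transpose_apply] at h₁ h₂
  simp [segmentBasis₁, segmentBasis₂, infinityBasis₁, infinityBasis₂, Fin.sum_univ_succ,
    momMat, momIdx, hess₁₁, hess₁₂, hess₂₂, h0] at h₁ h₂
  simp [evalPoly, Finset.sum_range_succ, hsupp, h0]
  linarith

theorem convex_lasserre2 (c : ℕ → ℕ → ℝ) : Convex ℝ (lasserre2 c) := by
  rintro x ⟨y, h00, h10, h01, hc, hM⟩ x' ⟨y', h00', h10', h01', hc', hM'⟩ a b ha hb hab
  refine ⟨fun i j => a * y i j + b * y' i j, ?_, ?_, ?_, ?_, ?_⟩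
  · simp [h00, h00', hab]
  · simp [h10, h10']
  · simp [h01, h01']
  · have : ∀ i j, c i j * (a * y i j + b * y' i j) = a * (c i j * y i j) + b * (c i j * y' i j) :=
      fun i j => by ring
    simp only [this, Finset.sum_add_distrib, ← Finset.mul_sum, hc, hc', mul_zero, add_zero]
  · exact (hM.smul ha).add (hM'.smul hb)

theorem zeros_subset_lasserre2 (c : ℕ → ℕ → ℝ) : {x : ℝ × ℝ | evalPoly c x = 0} ⊆ lasserre2 c := by
  intro x hx
  refine ⟨fun i j => x.1 ^ i * x.2 ^ j, by simp, by simp, by simp, ?_, ?_⟩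
  · simpa [evalPoly, mul_assoc] using hx
  · convert! posSemidef_vecMulVec_self_star
      (fun a : Fin 6 => x.1 ^ (momIdx a).1 * x.2 ^ (momIdx a).2) using 1
    ext a b
    simp only [momMat, of_apply, vecMulVec_apply, star_trivial]
    ring

/-- Lemma 5: if the quartic `p` is concave and `P = conv {x : p(x) = 0}`
is compact with nonempty interior, then the first Lasserre relaxation is exact: `P = P₂`. -/
theorem lasserre2_exact_of_concave (c : ℕ → ℕ → ℝ)
    (hsupp : ∀ i j : ℕ, 4 < i + j → c i j = 0)
    (hdeg : ∃ i j : ℕ, i + j = 4 ∧ c i j ≠ 0)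
    (hconc : ConcaveOn ℝ Set.univ (evalPoly c))
    (hcompact : IsCompact (convexHull ℝ {x : ℝ × ℝ | evalPoly c x = 0}))
    (hint : (interior (convexHull ℝ {x : ℝ × ℝ | evalPoly c x = 0})).Nonempty) :
    convexHull ℝ {x : ℝ × ℝ | evalPoly c x = 0} = lasserre2 c := by
  refine Set.Subset.antisymm (convexHull_min (zeros_subset_lasserre2 c) (convex_lasserre2 c)) ?_
  rintro x ⟨y, h00, h10, h01, hc, hM⟩
  have hx : 0 ≤ evalPoly c x := by
    have h := pseudoMoment_le_evalPoly hsupp hconc h00 hM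
    rwa [hc, h10, h01] at h
  refine mem_convexHull_zeros_of_nonneg (by simp [one_add_one_eq_two]) (continuous_evalPoly c) hconc
    (hcompact.isBounded.subset (subset_convexHull ℝ _)) ?_ hx
  exact convexHull_nonempty_iff.mp (hint.mono interior_subset)
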